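/- Let α > 0, let θ = θ̃_α be the unique zero of L(α,·) in (0, θ⁺_α) ∩ (0, π/4), and let φ, β, G, U, F, h be as in the context. Set V = −β(U)/α. Then for all (u,v) ∈ ℝ²: F(u+2U, v+2V) = F(u,v) and h(u+2U, v+2V) = h(u,v); that is, the minimal immersion X = (F,h) is periodic with period Z = 2(U+iV) ≠ 0. -/

import Mathlib

open Real Filter

noncomputable def Ccoef (α θ : ℝ) : ℝ := Real.sin (2 * θ) / (2 * α)

noncomputable def Ppoly (α θ x : ℝ) : ℝ :=
  α ^ 2 + Real.cos (2 * θ) * x ^ 2 - Ccoef α θ ^ 2 * x ^ 4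

noncomputable def thetaPlus (α : ℝ) : ℝ :=
  if 1 < α then Real.pi / 2 else (1 / 2) * Real.arccos (1 - 2 * α ^ 2)

def inOmega (α θ : ℝ) : Prop := 0 < α ∧ -thetaPlus α < θ ∧ θ < thetaPlus α

noncomputable def Lint (α θ : ℝ) : ℝ :=
  ∫ x in (-1 : ℝ)..1,
    (2 * α * Ccoef α θ ^ 2 * x ^ 2 - α * Real.cos (2 * θ)
        + Ccoef α θ ^ 2 * x ^ 2 * Real.sqrt (Ppoly α θ x)) /
      (Real.sqrt ((1 - x ^ 2) * Ppoly α θ x) * (α + Real.sqrt (Ppoly α θ x)))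

/-- Wirtinger derivative `f_z = (f_u - i f_v)/2` of a map `f : ℝ² → ℂ`. -/
noncomputable def wz (f : ℝ × ℝ → ℂ) (p : ℝ × ℝ) : ℂ :=
  (deriv (fun t => f (t, p.2)) p.1 - Complex.I * deriv (fun t => f (p.1, t)) p.2) / 2

/-- Wirtinger derivative `f_z̄ = (f_u + i f_v)/2` of a map `f : ℝ² → ℂ`. -/
noncomputable def wzbar (f : ℝ × ℝ → ℂ) (p : ℝ × ℝ) : ℂ :=
  (deriv (fun t => f (t, p.2)) p.1 + Complex.I * deriv (fun t => f (p.1, t)) p.2) / 2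

theorem Ppoly_one {α θ : ℝ} (hα : 0 < α) :
    Ppoly α θ 1 = ((2 * α ^ 2 + Real.cos (2 * θ)) ^ 2 - 1) / (4 * α ^ 2) := by
  have h := Real.sin_sq_add_cos_sq (2 * θ)
  unfold Ppoly Ccoef
  field_simp
  linear_combination -4 * h

theorem one_lt_of_lt_thetaPlus {α θ : ℝ} (hθ0 : 0 < θ) (hθ : θ < thetaPlus α)
    (hθ4 : θ < Real.pi / 4) : 1 < 2 * α ^ 2 + Real.cos (2 * θ) := by
  have hcos : 0 < Real.cos (2 * θ) :=
    Real.cos_pos_of_mem_Ioo ⟨by linarith [Real.pi_pos], by linarith⟩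
  by_cases h1 : 1 ≤ 2 * α ^ 2
  · linarith
  have hα1 : ¬ 1 < α := fun h => h1 (by nlinarith)
  rw [thetaPlus, if_neg hα1] at hθ
  have h2 : Real.cos (Real.arccos (1 - 2 * α ^ 2)) < Real.cos (2 * θ) :=
    Real.cos_lt_cos_of_nonneg_of_le_pi (by linarith) (Real.arccos_le_pi _) (by linarith)
  rw [Real.cos_arccos (by linarith) (by nlinarith [sq_nonneg α])] at h2
  linarith

/-- `P_{α,θ}(x)` is concave in `x²`, so its positivity on `[-1, 1]` is decided at the ends. -/
theorem Ppoly_pos {α θ x : ℝ} (hα : 0 < α) (h1 : 0 < Ppoly α θ 1) (hx : x ^ 2 ≤ 1) :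
    0 < Ppoly α θ x := by
  have hα2 : 0 < α ^ 2 := by positivity
  have hC := mul_nonneg (mul_nonneg (sq_nonneg (Ccoef α θ)) (sq_nonneg x)) (sub_nonneg.2 hx)
  have key : Ppoly α θ x = (1 - x ^ 2) * α ^ 2 + x ^ 2 * Ppoly α θ 1
      + Ccoef α θ ^ 2 * x ^ 2 * (1 - x ^ 2) := by unfold Ppoly; ring
  rw [key]
  rcases hx.lt_or_eq with hlt | heq
  · have := mul_pos (sub_pos.2 hlt) hα2
    have := mul_nonneg (sq_nonneg x) h1.le
    linarith
  · rw [heq] at hC ⊢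
    linarith

theorem neg_of_continuous_of_ne_zero {f : ℝ → ℝ} (hf : Continuous f) (h0 : f 0 ≤ 0)
    (hne : ∀ u, f u ≠ 0) (u : ℝ) : f u < 0 := by
  by_contra hu
  obtain ⟨w, hw⟩ := mem_range_of_exists_le_of_exists_ge hf ⟨0, h0⟩ ⟨u, not_lt.1 hu⟩
  exact hne w hw

/-- If `f'` has period `T`, then `f` is quasi-periodic. -/
theorem add_period_of_hasDerivAt {f f' : ℝ → ℝ} (hf : ∀ u, HasDerivAt f (f' u) u) (h0 : f 0 = 0)
    {T : ℝ} (hT : ∀ u, f' (u + T) = f' u) (u : ℝ) : f (u + T) = f u + f T := by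
  have hd : ∀ w, HasDerivAt (fun w => f (w + T) - f w) 0 w := fun w => by
    have := ((hf (w + T)).comp_add_const w T).fun_sub (hf w)
    rwa [hT, sub_self] at this
  have := is_const_of_deriv_eq_zero (fun w => (hd w).differentiableAt)
    (fun w => (hd w).deriv) u 0
  simp only [zero_add, h0] at this
  linarith

theorem image_cos_comp_Ioo {φ : ℝ → ℝ} {U : ℝ} (hφ : StrictAnti φ) (hc : Continuous φ)
    (hU : 0 < U) (h0 : φ 0 = 0) (hφU : φ U = -Real.pi) :
    (fun u => Real.cos (φ u)) '' Set.Ioo 0 U = Set.Ioo (-1) 1 := by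
  ext x
  constructor
  · rintro ⟨u, ⟨hu0, huU⟩, rfl⟩
    have h1 : φ u < 0 := h0 ▸ hφ hu0
    have h2 : -Real.pi < φ u := hφU ▸ hφ huU
    have hs : Real.sin (φ u) < 0 := Real.sin_neg_of_neg_of_neg_pi_lt h1 h2
    have := Real.sin_sq_add_cos_sq (φ u)
    exact ⟨by nlinarith, by nlinarith⟩
  · rintro ⟨hx1, hx2⟩
    have ha0 : 0 < Real.arccos x := Real.arccos_pos.2 hx2
    have haπ : Real.arccos x < Real.pi :=
      (Real.arccos_le_pi x).lt_of_ne fun h => hx1.not_ge (Real.arccos_eq_pi.1 h)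
    have hmem : -Real.arccos x ∈ Set.Ioo (φ U) (φ 0) := by
      rw [h0, hφU]; exact ⟨by linarith, by linarith⟩
    obtain ⟨u, hu, hux⟩ := intermediate_value_Ioo' hU.le hc.continuousOn hmem
    exact ⟨u, hu, by simp [hux, Real.cos_arccos hx1.le hx2.le]⟩

theorem injOn_cos_comp_Ioo {φ : ℝ → ℝ} {U : ℝ} (hφ : StrictAnti φ)
    (h0 : φ 0 = 0) (hφU : φ U = -Real.pi) :
    Set.InjOn (fun u => Real.cos (φ u)) (Set.Ioo 0 U) := by
  have hmem : ∀ u ∈ Set.Ioo 0 U, -φ u ∈ Set.Icc 0 Real.pi := fun u hu =>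
    ⟨by linarith [hφ hu.1], by linarith [hφ hu.2]⟩
  intro u hu w hw huw
  have := Real.injOn_cos (hmem u hu) (hmem w hw) (by simpa using huw)
  exact hφ.injective (neg_injective this)

/-- The substitution `x = cos φ(u)` in the integral defining `L(α, θ)`. -/
theorem Lint_eq_integral {α θ : ℝ} {φ φ' : ℝ → ℝ} (hφ : ∀ u, HasDerivAt φ (φ' u) u)
    (hφ' : ∀ u, φ' u < 0) (hsqrt : ∀ u, √(Ppoly α θ (Real.cos (φ u))) = -φ' u)
    (hα : 0 < α) (hφ0 : φ 0 = 0) {U : ℝ} (hU : 0 < U) (hφU : φ U = -Real.pi) :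
    Lint α θ = ∫ u in (0 : ℝ)..U,
      (α * ((Ccoef α θ ^ 2 * Real.cos (φ u) ^ 2 - Real.cos (2 * θ)) / (α - φ' u))
        + Ccoef α θ * (Ccoef α θ * Real.cos (φ u) ^ 2)) := by
  have hanti : StrictAnti φ := strictAnti_of_hasDerivAt_neg hφ hφ'
  have hc : Continuous φ := continuous_iff_continuousAt.2 fun u => (hφ u).continuousAt
  have hd : ∀ u ∈ Set.Ioo 0 U, HasDerivWithinAt (fun u => Real.cos (φ u))
      (-Real.sin (φ u) * φ' u) (Set.Ioo 0 U) u := fun u _ => (hφ u).cos.hasDerivWithinAt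
  rw [Lint, intervalIntegral.integral_of_le (by norm_num), intervalIntegral.integral_of_le hU.le,
    MeasureTheory.integral_Ioc_eq_integral_Ioo, MeasureTheory.integral_Ioc_eq_integral_Ioo,
    ← image_cos_comp_Ioo hanti hc hU hφ0 hφU,
    MeasureTheory.integral_image_eq_integral_abs_deriv_smul measurableSet_Ioo hd
      (injOn_cos_comp_Ioo hanti hφ0 hφU)]
  refine MeasureTheory.setIntegral_congr_fun measurableSet_Ioo fun u hu => ?_
  have hs : Real.sin (φ u) < 0 :=
    Real.sin_neg_of_neg_of_neg_pi_lt (hφ0 ▸ hanti hu.1) (hφU ▸ hanti hu.2)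
  have hprod : 0 < Real.sin (φ u) * φ' u := mul_pos_of_neg_of_neg hs (hφ' u)
  have hroot : √((1 - Real.cos (φ u) ^ 2) * Ppoly α θ (Real.cos (φ u)))
      = Real.sin (φ u) * φ' u := by
    rw [← Real.sin_sq, Real.sqrt_mul (sq_nonneg _), hsqrt, Real.sqrt_sq_eq_abs, abs_of_neg hs]
    ring
  have habs : |-Real.sin (φ u) * φ' u| = Real.sin (φ u) * φ' u := by
    rw [neg_mul, abs_neg, abs_of_pos hprod]
  have hden : α - φ' u ≠ 0 := by linarith [hφ' u]
  have hs' := hs.ne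
  have hφ'u := (hφ' u).ne
  simp only [smul_eq_mul]
  rw [habs, hroot, hsqrt, ← sub_eq_add_neg]
  field_simp
  ring

/-- For `θ = θ̃_α` the zero of `L(α,·)`, the immersion `X = (F, h)` is periodic with
period `Z = 2(U + iV) ≠ 0`, where `V = -β(U)/α`. -/
theorem statement_12 {α θ : ℝ} (hα : 0 < α)
    (hθmem : θ ∈ Set.Ioo 0 (thetaPlus α) ∩ Set.Ioo 0 (Real.pi / 4))
    (hθzero : Lint α θ = 0)
    (φ φ' β G Gd : ℝ → ℝ)
    (hφ : ∀ u, HasDerivAt φ (φ' u) u) (hφ'c : Continuous φ')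
    (hode : ∀ u, (φ' u) ^ 2 = Ppoly α θ (Real.cos (φ u)))
    (hφ0 : φ 0 = 0) (hφ'0 : φ' 0 ≤ 0)
    (hβ : ∀ u, HasDerivAt β (Ccoef α θ * Real.cos (φ u) ^ 2) u) (hβ0 : β 0 = 0)
    (hGd : ∀ u, Gd u =
      (Ccoef α θ ^ 2 * Real.cos (φ u) ^ 2 - Real.cos (2 * θ)) / (α - φ' u))
    (hG : ∀ u, HasDerivAt G (Gd u) u) (hG0 : G 0 = 0)
    (U : ℝ) (hU : 0 < U) (hUper : ∀ u, φ (u + U) = φ u - Real.pi)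
    (V : ℝ) (hV : V = -β U / α)
    (F : ℝ × ℝ → ℂ) (h : ℝ × ℝ → ℝ)
    (hF : ∀ p : ℝ × ℝ, F p =
      ((Gd p.1 / α * Real.cos (φ p.1) * Real.sinh (α * p.2 + β p.1)
        - Ccoef α θ / α * Real.sin (φ p.1) * Real.cosh (α * p.2 + β p.1) : ℝ) : ℂ)
      + Complex.I * ((Ccoef α θ * p.2 - G p.1 : ℝ) : ℂ))
    (hh : ∀ p : ℝ × ℝ, h p =
      -(1 / α) * (Gd p.1 * Real.sin (φ p.1) + Ccoef α θ ^ 2 / α * Real.sin (φ p.1)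
          + (Ccoef α θ * p.2 - G p.1) * Gd p.1 / 2 * Real.cos (φ p.1))
        * Real.sinh (α * p.2 + β p.1)
      + (1 / α) * (-(Ccoef α θ * Real.cos (φ p.1)) + Ccoef α θ * Gd p.1 / α * Real.cos (φ p.1)
          + Ccoef α θ * (Ccoef α θ * p.2 - G p.1) / 2 * Real.sin (φ p.1))
        * Real.cosh (α * p.2 + β p.1)) :
    (∀ u v : ℝ, F (u + 2 * U, v + 2 * V) = F (u, v) ∧ h (u + 2 * U, v + 2 * V) = h (u, v)) ∧
    (2 * ((U : ℂ) + (V : ℂ) * Complex.I) ≠ 0) := by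
  have hone := one_lt_of_lt_thetaPlus hθmem.1.1 hθmem.1.2 hθmem.2.2
  have hP1 : 0 < Ppoly α θ 1 := by
    rw [Ppoly_one hα]
    exact div_pos (by nlinarith) (by positivity)
  have hpos : ∀ x : ℝ, x ^ 2 ≤ 1 → 0 < Ppoly α θ x := fun x hx => Ppoly_pos hα hP1 hx
  have hne : ∀ u, φ' u ≠ 0 := fun u h0 => by
    have := hpos _ (Real.cos_sq_le_one (φ u))
    rw [← hode u, h0] at this
    simp at this
  have hneg : ∀ u, φ' u < 0 := neg_of_continuous_of_ne_zero hφ'c hφ'0 hne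
  have hsqrt : ∀ u, √(Ppoly α θ (Real.cos (φ u))) = -φ' u := fun u => by
    rw [← hode u, Real.sqrt_sq_eq_abs, abs_of_neg (hneg u)]
  have hφU : φ U = -Real.pi := by simpa [hφ0] using hUper 0
  have hcos : ∀ u, Real.cos (φ (u + U)) = -Real.cos (φ u) := fun u => by
    rw [hUper, Real.cos_sub_pi]
  have hsin : ∀ u, Real.sin (φ (u + U)) = -Real.sin (φ u) := fun u => by
    rw [hUper, Real.sin_sub_pi]
  have hφ'U : ∀ u, φ' (u + U) = φ' u := fun u => by
    have h1 := (hφ (u + U)).comp_add_const u U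
    simp only [hUper] at h1
    exact h1.unique ((hφ u).sub_const _)
  have hGdU : ∀ u, Gd (u + U) = Gd u := fun u => by
    rw [hGd, hGd, hcos, hφ'U, neg_sq]
  have hβU := add_period_of_hasDerivAt hβ hβ0 (T := U) fun u => by rw [hcos, neg_sq]
  have hGU := add_period_of_hasDerivAt hG hG0 hGdU
  have hclose : α * G U + Ccoef α θ * β U = 0 := by
    have hcφ : Continuous φ := continuous_iff_continuousAt.2 fun u => (hφ u).continuousAt
    have hcont : Continuous fun u =>
        (Ccoef α θ ^ 2 * Real.cos (φ u) ^ 2 - Real.cos (2 * θ)) / (α - φ' u) :=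
      Continuous.div (by fun_prop) (by fun_prop) fun u => by linarith [hneg u]
    have hD : ∀ u, HasDerivAt (fun u => α * G u + Ccoef α θ * β u)
        (α * ((Ccoef α θ ^ 2 * Real.cos (φ u) ^ 2 - Real.cos (2 * θ)) / (α - φ' u))
          + Ccoef α θ * (Ccoef α θ * Real.cos (φ u) ^ 2)) u := fun u =>
      ((hGd u ▸ hG u).const_mul α).add ((hβ u).const_mul _)
    rw [Lint_eq_integral hφ hneg hsqrt hα hφ0 hU hφU,
      intervalIntegral.integral_eq_sub_of_hasDerivAt (fun u _ => hD u)
        (Continuous.intervalIntegrable (by fun_prop) _ _)] at hθzero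
    simpa [hG0, hβ0] using hθzero
  have hαV : α * V = -β U := by rw [hV]; field_simp
  have hCV : Ccoef α θ * V = G U :=
    mul_left_cancel₀ hα.ne' (by linear_combination Ccoef α θ * hαV - hclose)
  have htwo : ∀ u, u + 2 * U = u + U + U := fun u => by ring
  refine ⟨fun u v => ?_, fun h0 => ?_⟩
  · have hA : α * (v + 2 * V) + β (u + 2 * U) = α * v + β u := by
      rw [htwo, hβU, hβU]; linear_combination 2 * hαV
    have hB : Ccoef α θ * (v + 2 * V) - G (u + 2 * U) = Ccoef α θ * v - G u := by
      rw [htwo, hGU, hGU]; linear_combination 2 * hCV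
    have hc2 : Real.cos (φ (u + 2 * U)) = Real.cos (φ u) := by rw [htwo, hcos, hcos, neg_neg]
    have hs2 : Real.sin (φ (u + 2 * U)) = Real.sin (φ u) := by rw [htwo, hsin, hsin, neg_neg]
    have hG2 : Gd (u + 2 * U) = Gd u := by rw [htwo, hGdU, hGdU]
    constructor
    · rw [hF, hF]; dsimp only; rw [hA, hB, hc2, hs2, hG2]
    · rw [hh, hh]; dsimp only; rw [hA, hB, hc2, hs2, hG2]
  · have := congrArg Complex.re h0
    simp at this
    exact hU.ne' this
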